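/- arXiv:2406.10570 — 2 statements merged into one kernel-verified Lean document; each statement's English description precedes it below -/
import Mathlib

section
/- Let ρ be a positive semidefinite 4×4 complex matrix (on ℂ² ⊗ ℂ²) with Tr ρ = 1, and suppose that for every w ∈ {1,2,3} there exist real numbers α_w ≥ 0 and α'_w ≥ 0 such that ρ = α_w·(Π_{0,w} ⊗ E₀₀) + α'_w·(Π_{1,w} ⊗ E₀₀). Then ρ = (1/2)·1₂ ⊗ E₀₀, and α_w = α'_w = 1/2 for every w. -/
open Matrix Kronecker Complex
open scoped BigOperators ComplexOrder

noncomputable def Pauli : Fin 3 → Matrix (Fin 2) (Fin 2) ℂ :=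
  ![!![0, 1; 1, 0], !![0, -Complex.I; Complex.I, 0], !![1, 0; 0, -1]]

noncomputable def PProj (d : Fin 2) (w : Fin 3) : Matrix (Fin 2) (Fin 2) ℂ :=
  ((1 : ℂ) / 2) • ((1 : Matrix (Fin 2) (Fin 2) ℂ) + ((-1 : ℂ) ^ (d : ℕ)) • Pauli w)

noncomputable def E00 : Matrix (Fin 2) (Fin 2) ℂ := !![1, 0; 0, 0]
noncomputable def E11 : Matrix (Fin 2) (Fin 2) ℂ := !![0, 0; 0, 1]

def IsNSAssemblage {D W ι : Type*} [Fintype D] [Fintype ι]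
    (σ : D → W → Matrix ι ι ℂ) : Prop :=
  (∀ d w, (σ d w).PosSemidef) ∧
  (∀ w w', ∑ d, σ d w = ∑ d, σ d w') ∧
  (∀ w, (∑ d, σ d w).trace = 1)

def IsExtremalNSAssemblage {D W ι : Type*} [Fintype D] [Fintype ι]
    (σ : D → W → Matrix ι ι ℂ) : Prop :=
  IsNSAssemblage σ ∧
  ∀ (t : ℝ) (τ τ' : D → W → Matrix ι ι ℂ), 0 < t → t < 1 →
    IsNSAssemblage τ → IsNSAssemblage τ' →
    (∀ d w, σ d w = (t : ℂ) • τ d w + ((1 - t : ℝ) : ℂ) • τ' d w) →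
    ∀ d w, τ d w = σ d w ∧ τ' d w = σ d w

noncomputable def ptrace1 {α β : Type*} [Fintype α] (X : Matrix (α × β) (α × β) ℂ) :
    Matrix β β ℂ :=
  Matrix.of fun i j => ∑ p : α, X (p, i) (p, j)

noncomputable def ptrace2 {α β : Type*} [Fintype β] (X : Matrix (α × β) (α × β) ℂ) :
    Matrix α α ℂ :=
  Matrix.of fun i j => ∑ p : β, X (i, p) (j, p)

noncomputable def ptrace12 {α β γ : Type*} [Fintype α] [Fintype β]
    (X : Matrix (α × β × γ) (α × β × γ) ℂ) : Matrix γ γ ℂ :=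
  Matrix.of fun i j => ∑ p : α, ∑ q : β, X (p, q, i) (p, q, j)

def IsQuantumAssemblage {A B X Y ι : Type*} [Fintype A] [Fintype B]
    [Fintype ι] [DecidableEq ι]
    (σ : A → B → X → Y → Matrix ι ι ℂ) : Prop :=
  ∃ (nA nB : ℕ)
    (ρ : Matrix (Fin nA × Fin nB × ι) (Fin nA × Fin nB × ι) ℂ)
    (M : A → X → Matrix (Fin nA) (Fin nA) ℂ)
    (N : B → Y → Matrix (Fin nB) (Fin nB) ℂ),
    ρ.PosSemidef ∧ ρ.trace = 1 ∧
    (∀ a x, (M a x).PosSemidef) ∧ (∀ x, ∑ a, M a x = 1) ∧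
    (∀ b y, (N b y).PosSemidef) ∧ (∀ y, ∑ b, N b y = 1) ∧
    (∀ a b x y, σ a b x y =
      ptrace12 ((M a x ⊗ₖ (N b y ⊗ₖ (1 : Matrix ι ι ℂ))) * ρ))

lemma smul_PProj_kronecker_add (a b : ℝ) (w : Fin 3) (N : Matrix (Fin 2) (Fin 2) ℂ) :
    (a : ℂ) • (PProj 0 w ⊗ₖ N) + (b : ℂ) • (PProj 1 w ⊗ₖ N) =
      ((((a + b) / 2 : ℝ) : ℂ) • (1 : Matrix (Fin 2) (Fin 2) ℂ) +
        (((a - b) / 2 : ℝ) : ℂ) • Pauli w) ⊗ₖ N := by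
  ext i j
  simp [PProj, kroneckerMap_apply]
  ring

lemma trace_Pauli (w : Fin 3) : (Pauli w).trace = 0 := by
  fin_cases w <;> simp [Pauli, trace_fin_two]

lemma trace_E00 : E00.trace = 1 := by
  simp [E00, trace_fin_two]

lemma kronecker_E00_injective :
    Function.Injective fun M : Matrix (Fin 2) (Fin 2) ℂ => M ⊗ₖ E00 := by
  intro M N h
  ext i j
  simpa [kroneckerMap_apply, E00] using congrFun (congrFun h (i, 0)) (j, 0)

/-- Multiples of the three Pauli matrices agree only when they all vanish. -/
lemma eq_zero_of_smul_Pauli_eq {c : Fin 3 → ℝ}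
    (h : ∀ w w', (c w : ℂ) • Pauli w = (c w' : ℂ) • Pauli w') (w : Fin 3) : c w = 0 := by
  have hx : c 0 = 0 := by simpa [Pauli] using congrFun (congrFun (h 0 2) 0) 1
  have hP : Pauli w ≠ 0 := by
    intro h0
    fin_cases w
    · simpa [Pauli] using congrFun (congrFun h0 0) 1
    · simpa [Pauli] using congrFun (congrFun h0 0) 1
    · simpa [Pauli] using congrFun (congrFun h0 0) 0
  simpa [hx, hP] using h w 0

theorem stmt4 (ρ : Matrix (Fin 2 × Fin 2) (Fin 2 × Fin 2) ℂ)
    (hρ : ρ.PosSemidef) (htr : ρ.trace = 1)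
    (α α' : Fin 3 → ℝ) (hα : ∀ w, 0 ≤ α w) (hα' : ∀ w, 0 ≤ α' w)
    (hdecomp : ∀ w, ρ = (α w : ℂ) • (PProj 0 w ⊗ₖ E00) + (α' w : ℂ) • (PProj 1 w ⊗ₖ E00)) :
    ρ = ((1 : ℂ) / 2) • ((1 : Matrix (Fin 2) (Fin 2) ℂ) ⊗ₖ E00) ∧
      ∀ w, α w = 1 / 2 ∧ α' w = 1 / 2 := by
  simp only [smul_PProj_kronecker_add] at hdecomp
  have hsum (w : Fin 3) : α w + α' w = 1 := by
    have h := htr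
    rw [hdecomp w, trace_kronecker, trace_E00, trace_add, trace_smul, trace_smul, trace_Pauli,
      trace_one] at h
    simpa using congrArg Complex.re h
  have hdiff (w : Fin 3) : (α w - α' w) / 2 = 0 := by
    refine eq_zero_of_smul_Pauli_eq (c := fun w => (α w - α' w) / 2) (fun w w' => ?_) w
    have h := kronecker_E00_injective ((hdecomp w).symm.trans (hdecomp w'))
    rw [hsum, hsum] at h
    exact add_left_cancel h
  refine ⟨?_, fun w => ?_⟩
  · rw [hdecomp 0, hsum, hdiff]
    simp [smul_kronecker]
  · have := hsum w
    have := hdiff w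
    constructor <;> linarith
end

section
/- Let n ≥ 1, let A, B, X, Y be finite sets, and let f : A × B × (Fin n → Fin 2) × X × Y × (Fin n → Fin 3) → ℝ. For d : Fin n → Fin 2 and w : Fin n → Fin 3 let Π^{(n)}_{d,w} denote the n-fold Kronecker product Π_{d(1),w(1)} ⊗ ⋯ ⊗ Π_{d(n),w(n)}, a 2^n × 2^n matrix. Suppose that for every quantum assemblage (σ_{ab|xy}) of 2^n×2^n matrices, the real part of ∑_{a,b,d,x,y,w} f(a,b,d,x,y,w)·Tr(Π^{(n)}_{d,w}·σ_{ab|xy}) is nonnegative. For r ∈ [0,1] define σ^{R,n}_{d|w} := r·(Π^{(n)}_{d,w} ⊗ E₀₀) + (1−r)·((Π^{(n)}_{d,w})ᵀ ⊗ E₁₁). Then for every r ∈ [0,1], every quantum assemblage (σ_{ab|xy}) of 2^n×2^n matrices, and every positive semidefinite matrix M₀ on (ℂ^{2^n} ⊗ ℂ²) ⊗ ℂ^{2^n} with M₀ ≤ 1, the real part of ∑_{a,b,d,x,y,w} f(a,b,d,x,y,w)·Tr(M₀·(σ^{R,n}_{d|w} ⊗ σ_{ab|xy})) is nonnegative. 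-/
open Matrix Kronecker Complex
open scoped BigOperators ComplexOrder

/-- The n-fold Kronecker product `Π_{d 0, w 0} ⊗ ⋯ ⊗ Π_{d (n-1), w (n-1)}`, entrywise. -/
noncomputable def PProjN {n : ℕ} (d : Fin n → Fin 2) (w : Fin n → Fin 3) :
    Matrix (Fin n → Fin 2) (Fin n → Fin 2) ℂ :=
  Matrix.of fun i j => ∏ k, PProj (d k) (w k) (i k) (j k)

/-- `σ^{R,n}_{d|w} = r (Π^{(n)}_{d,w} ⊗ E₀₀) + (1-r) ((Π^{(n)}_{d,w})ᵀ ⊗ E₁₁)`. -/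
noncomputable def sigmaRN {n : ℕ} (r : ℝ) (d : Fin n → Fin 2) (w : Fin n → Fin 3) :
    Matrix ((Fin n → Fin 2) × Fin 2) ((Fin n → Fin 2) × Fin 2) ℂ :=
  (r : ℂ) • (PProjN d w ⊗ₖ E00) + ((1 - r : ℝ) : ℂ) • ((PProjN d w)ᵀ ⊗ₖ E11)

/-- A quantum assemblage without the normalization of the state. -/
def IsUnnormalizedQuantumAssemblage {A B X Y ι : Type*} [Fintype A] [Fintype B]
    [Fintype ι] [DecidableEq ι] (σ : A → B → X → Y → Matrix ι ι ℂ) : Prop :=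
  ∃ (nA nB : ℕ)
    (ρ : Matrix (Fin nA × Fin nB × ι) (Fin nA × Fin nB × ι) ℂ)
    (M : A → X → Matrix (Fin nA) (Fin nA) ℂ)
    (N : B → Y → Matrix (Fin nB) (Fin nB) ℂ),
    ρ.PosSemidef ∧
    (∀ a x, (M a x).PosSemidef) ∧ (∀ x, ∑ a, M a x = 1) ∧
    (∀ b y, (N b y).PosSemidef) ∧ (∀ y, ∑ b, N b y = 1) ∧
    (∀ a b x y, σ a b x y =
      ptrace12 ((M a x ⊗ₖ (N b y ⊗ₖ (1 : Matrix ι ι ℂ))) * ρ))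

section PartialTrace

variable {α β γ : Type*} [Fintype α] [Fintype β]

theorem ptrace12_smul (c : ℂ) (X : Matrix (α × β × γ) (α × β × γ) ℂ) :
    ptrace12 (c • X) = c • ptrace12 X := by
  ext i j
  simp [ptrace12, Finset.mul_sum]

theorem ptrace12_zero : ptrace12 (0 : Matrix (α × β × γ) (α × β × γ) ℂ) = 0 := by
  ext i j
  simp [ptrace12]

theorem ptrace12_transpose (X : Matrix (α × β × γ) (α × β × γ) ℂ) :
    (ptrace12 X)ᵀ = ptrace12 Xᵀ := rfl

variable [Fintype γ]

theorem ptrace12_kronecker_one_mul_comm [DecidableEq γ] (M : Matrix α α ℂ) (N : Matrix β β ℂ)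
    (X : Matrix (α × β × γ) (α × β × γ) ℂ) :
    ptrace12 ((M ⊗ₖ (N ⊗ₖ (1 : Matrix γ γ ℂ))) * X) =
      ptrace12 (X * (M ⊗ₖ (N ⊗ₖ (1 : Matrix γ γ ℂ)))) := by
  ext i j
  simp only [ptrace12, Matrix.of_apply, Matrix.mul_apply, Fintype.sum_prod_type,
    Matrix.kroneckerMap_apply, Matrix.one_apply, mul_ite, ite_mul, mul_one, zero_mul, mul_zero,
    Finset.sum_ite_eq, Finset.sum_ite_eq', Finset.mem_univ, if_true]
  simp only [Finset.sum_comm (γ := β) (α := α)]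
  rw [Finset.sum_comm]
  refine Finset.sum_congr rfl fun p _ => Finset.sum_congr rfl fun p' _ => ?_
  rw [Finset.sum_comm]
  refine Finset.sum_congr rfl fun q _ => Finset.sum_congr rfl fun q' _ => ?_
  ring

variable [DecidableEq α] [DecidableEq β]

theorem ptrace12_one_kronecker_mul (V : Matrix γ γ ℂ)
    (X : Matrix (α × β × γ) (α × β × γ) ℂ) :
    ptrace12 (((1 : Matrix α α ℂ) ⊗ₖ ((1 : Matrix β β ℂ) ⊗ₖ V)) * X) = V * ptrace12 X := by
  ext i j
  simp only [ptrace12, Matrix.of_apply, Matrix.mul_apply, Fintype.sum_prod_type,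
    Matrix.kroneckerMap_apply, Matrix.one_apply, ite_mul, one_mul, zero_mul,
    Finset.sum_ite_irrel, Finset.sum_const_zero, Finset.sum_ite_eq, Finset.mem_univ, if_true,
    Finset.mul_sum]
  rw [Finset.sum_comm (γ := γ)]
  refine Finset.sum_congr rfl fun p _ => ?_
  rw [Finset.sum_comm]

theorem ptrace12_mul_one_kronecker (V : Matrix γ γ ℂ)
    (X : Matrix (α × β × γ) (α × β × γ) ℂ) :
    ptrace12 (X * ((1 : Matrix α α ℂ) ⊗ₖ ((1 : Matrix β β ℂ) ⊗ₖ V))) = ptrace12 X * V := by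
  have h := congrArg Matrix.transpose (ptrace12_one_kronecker_mul Vᵀ Xᵀ)
  simpa [ptrace12_transpose, Matrix.transpose_mul, ← Matrix.kroneckerMap_transpose] using h

end PartialTrace

namespace IsUnnormalizedQuantumAssemblage

variable {A B X Y ι : Type*} [Fintype A] [Fintype B] [Fintype ι] [DecidableEq ι]
  {σ : A → B → X → Y → Matrix ι ι ℂ}

theorem conj (h : IsUnnormalizedQuantumAssemblage σ) (V : Matrix ι ι ℂ) :
    IsUnnormalizedQuantumAssemblage fun a b x y => V * σ a b x y * Vᴴ := by
  obtain ⟨nA, nB, ρ, M, N, hρ, hM, hM1, hN, hN1, hσ⟩ := h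
  let W : Matrix (Fin nA × Fin nB × ι) (Fin nA × Fin nB × ι) ℂ := 1 ⊗ₖ (1 ⊗ₖ V)
  have hW : Wᴴ = 1 ⊗ₖ (1 ⊗ₖ Vᴴ) := by
    simp [W, Matrix.conjTranspose_kronecker]
  refine ⟨nA, nB, W * ρ * Wᴴ, M, N, hρ.mul_mul_conjTranspose_same W, hM, hM1, hN, hN1, ?_⟩
  intro a b x y
  beta_reduce
  have hcomm : (M a x ⊗ₖ (N b y ⊗ₖ (1 : Matrix ι ι ℂ))) * W =
      W * (M a x ⊗ₖ (N b y ⊗ₖ (1 : Matrix ι ι ℂ))) := by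
    simp only [W, ← Matrix.mul_kronecker_mul, Matrix.one_mul, Matrix.mul_one]
  rw [hσ, ← Matrix.mul_assoc, ← Matrix.mul_assoc, hcomm, hW, ptrace12_mul_one_kronecker,
    Matrix.mul_assoc W, ptrace12_one_kronecker_mul]

theorem transpose (h : IsUnnormalizedQuantumAssemblage σ) :
    IsUnnormalizedQuantumAssemblage fun a b x y => (σ a b x y)ᵀ := by
  obtain ⟨nA, nB, ρ, M, N, hρ, hM, hM1, hN, hN1, hσ⟩ := h
  refine ⟨nA, nB, ρᵀ, fun a x => (M a x)ᵀ, fun b y => (N b y)ᵀ, hρ.transpose,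
    fun a x => (hM a x).transpose, fun x => ?_, fun b y => (hN b y).transpose, fun y => ?_, ?_⟩
  · rw [← Matrix.transpose_sum, hM1, Matrix.transpose_one]
  · rw [← Matrix.transpose_sum, hN1, Matrix.transpose_one]
  · intro a b x y
    beta_reduce
    rw [hσ, ptrace12_transpose, Matrix.transpose_mul, ptrace12_kronecker_one_mul_comm]
    simp [← Matrix.kroneckerMap_transpose]

theorem exists_eq_smul (h : IsUnnormalizedQuantumAssemblage σ) :
    (∀ a b x y, σ a b x y = 0) ∨
      ∃ (t : ℝ) (τ : A → B → X → Y → Matrix ι ι ℂ), 0 ≤ t ∧ IsQuantumAssemblage τ ∧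
        ∀ a b x y, σ a b x y = (t : ℂ) • τ a b x y := by
  obtain ⟨nA, nB, ρ, M, N, hρ, hM, hM1, hN, hN1, hσ⟩ := h
  by_cases h0 : ρ.trace = 0
  · left
    intro a b x y
    rw [hσ, hρ.trace_eq_zero_iff.mp h0, Matrix.mul_zero, ptrace12_zero]
  · right
    obtain ⟨t, ht, htr⟩ : ∃ t : ℝ, 0 ≤ t ∧ (t : ℂ) = ρ.trace := by
      have h := Complex.nonneg_iff.mp hρ.trace_nonneg
      exact ⟨_, h.1, Complex.ext rfl h.2⟩
    rw [← htr] at h0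
    refine ⟨t, fun a b x y => ptrace12 ((M a x ⊗ₖ (N b y ⊗ₖ (1 : Matrix ι ι ℂ))) *
      ((t : ℂ)⁻¹ • ρ)), ht, ⟨nA, nB, (t : ℂ)⁻¹ • ρ, M, N, hρ.smul ?_, ?_, hM, hM1, hN, hN1,
        fun _ _ _ _ => rfl⟩, ?_⟩
    · rw [← Complex.ofReal_inv]
      exact Complex.zero_le_real.mpr (inv_nonneg.mpr ht)
    · rw [Matrix.trace_smul, ← htr, smul_eq_mul, inv_mul_cancel₀ h0]
    · intro a b x y
      beta_reduce
      rw [Matrix.mul_smul, ptrace12_smul, smul_smul, mul_inv_cancel₀ h0, one_smul, hσ]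

end IsUnnormalizedQuantumAssemblage

theorem IsQuantumAssemblage.isUnnormalizedQuantumAssemblage {A B X Y ι : Type*} [Fintype A]
    [Fintype B] [Fintype ι] [DecidableEq ι] {σ : A → B → X → Y → Matrix ι ι ℂ}
    (h : IsQuantumAssemblage σ) : IsUnnormalizedQuantumAssemblage σ := by
  obtain ⟨nA, nB, ρ, M, N, hρ, -, h⟩ := h
  exact ⟨nA, nB, ρ, M, N, hρ, h⟩

open scoped MatrixOrder in
theorem Matrix.PosSemidef.exists_eq_conjTranspose_mul_self {ι : Type*} [Fintype ι]
    [DecidableEq ι] {K : Matrix ι ι ℂ} (hK : K.PosSemidef) :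
    ∃ L : Matrix ι ι ℂ, K = Lᴴ * L :=
  CStarAlgebra.nonneg_iff_eq_star_mul_self.mp hK.nonneg

theorem trace_conjTranspose_mul_self_mul_kronecker {κ ι : Type*} [Fintype κ] [Fintype ι]
    (L : Matrix κ (ι × ι) ℂ) (P S : Matrix ι ι ℂ) :
    ((Lᴴ * L) * (P ⊗ₖ S)).trace =
      ∑ l, (Pᵀ * (Matrix.of (fun i t => L l (i, t)) * S *
        (Matrix.of fun i t => L l (i, t))ᴴ)).trace := by
  rw [Matrix.mul_assoc, Matrix.trace_mul_comm, Matrix.trace]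
  refine Finset.sum_congr rfl fun l _ => ?_
  simp only [Matrix.trace, Matrix.diag_apply, Matrix.mul_apply, Matrix.kroneckerMap_apply,
    Matrix.conjTranspose_apply, Matrix.transpose_apply, Matrix.of_apply, Fintype.sum_prod_type,
    Finset.sum_mul, Finset.mul_sum]
  refine Finset.sum_congr rfl fun j _ => ?_
  rw [Finset.sum_comm]
  refine Finset.sum_congr rfl fun i _ => Finset.sum_congr rfl fun s _ =>
    Finset.sum_congr rfl fun t _ => ?_
  ring

theorem trace_mul_kronecker_kronecker {ι κ : Type*} [Fintype ι] [Fintype κ]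
    (M : Matrix ((ι × Fin 2) × κ) ((ι × Fin 2) × κ) ℂ) (P : Matrix ι ι ℂ) (S : Matrix κ κ ℂ) :
    (M * ((P ⊗ₖ E00) ⊗ₖ S)).trace =
      (M.submatrix (fun p : ι × κ => ((p.1, 0), p.2)) (fun p : ι × κ => ((p.1, 0), p.2)) *
        (P ⊗ₖ S)).trace ∧
    (M * ((P ⊗ₖ E11) ⊗ₖ S)).trace =
      (M.submatrix (fun p : ι × κ => ((p.1, 1), p.2)) (fun p : ι × κ => ((p.1, 1), p.2)) *
        (P ⊗ₖ S)).trace := by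
  constructor <;>
  simp [Matrix.trace, Matrix.mul_apply, Fintype.sum_prod_type, E00, E11]

/-- The Bell-type functional with coefficients `f` on families of operators. -/
noncomputable def bellFunctional {n : ℕ} {A B X Y : Type*} [Fintype A] [Fintype B] [Fintype X]
    [Fintype Y] (f : A × B × (Fin n → Fin 2) × X × Y × (Fin n → Fin 3) → ℝ) :
    (A → B → X → Y → (Fin n → Fin 2) → (Fin n → Fin 3) → ℂ) →ₗ[ℂ] ℂ where
  toFun g := ∑ a, ∑ b, ∑ d, ∑ x, ∑ y, ∑ w, (f (a, b, d, x, y, w) : ℂ) * g a b x y d w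
  map_add' g g' := by simp only [Pi.add_apply, mul_add, Finset.sum_add_distrib]
  map_smul' c g := by
    simp only [Pi.smul_apply, smul_eq_mul, Finset.mul_sum, RingHom.id_apply, mul_left_comm]

theorem stmt12 {n : ℕ} (hn : 1 ≤ n)
    {A B X Y : Type*} [Fintype A] [Fintype B] [Fintype X] [Fintype Y]
    (f : A × B × (Fin n → Fin 2) × X × Y × (Fin n → Fin 3) → ℝ)
    (hpos : ∀ σ : A → B → X → Y → Matrix (Fin n → Fin 2) (Fin n → Fin 2) ℂ,
      IsQuantumAssemblage σ →
      0 ≤ (∑ a, ∑ b, ∑ d, ∑ x, ∑ y, ∑ w,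
        (f (a, b, d, x, y, w) : ℂ) * (PProjN d w * σ a b x y).trace).re)
    (r : ℝ) (hr0 : 0 ≤ r) (hr1 : r ≤ 1)
    (σ : A → B → X → Y → Matrix (Fin n → Fin 2) (Fin n → Fin 2) ℂ)
    (hσ : IsQuantumAssemblage σ)
    (M₀ : Matrix (((Fin n → Fin 2) × Fin 2) × (Fin n → Fin 2))
      (((Fin n → Fin 2) × Fin 2) × (Fin n → Fin 2)) ℂ)
    (hM₀ : M₀.PosSemidef) (hM₀le : (1 - M₀).PosSemidef) :
    0 ≤ (∑ a, ∑ b, ∑ d, ∑ x, ∑ y, ∑ w,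
      (f (a, b, d, x, y, w) : ℂ) * (M₀ * (sigmaRN r d w ⊗ₖ σ a b x y)).trace).re := by
  have hcone : ∀ τ : A → B → X → Y → Matrix (Fin n → Fin 2) (Fin n → Fin 2) ℂ,
      IsUnnormalizedQuantumAssemblage τ →
      0 ≤ (bellFunctional f fun a b x y d w => (PProjN d w * τ a b x y).trace).re := by
    intro τ hτ
    obtain h0 | ⟨t, τ', ht, hτ', h⟩ := hτ.exists_eq_smul
    · simp [bellFunctional, h0]
    · have : (fun a b x y d w => (PProjN d w * τ a b x y).trace) =
          (t : ℂ) • fun a b x y (d : Fin n → Fin 2) w => (PProjN d w * τ' a b x y).trace := by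
        funext a b x y d w
        simp [h]
      rw [this, map_smul, smul_eq_mul, Complex.re_ofReal_mul]
      exact mul_nonneg ht (hpos τ' hτ')
  have hτ := hσ.isUnnormalizedQuantumAssemblage
  have hdirect : ∀ K : Matrix ((Fin n → Fin 2) × (Fin n → Fin 2)) _ ℂ, K.PosSemidef →
      0 ≤ (bellFunctional f fun a b x y d w => (K * (PProjN d w ⊗ₖ σ a b x y)).trace).re := by
    intro K hK
    obtain ⟨L, rfl⟩ := hK.exists_eq_conjTranspose_mul_self
    have : (fun a b x y (d : Fin n → Fin 2) w =>
          ((Lᴴ * L) * (PProjN d w ⊗ₖ σ a b x y)).trace) =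
        ∑ l, fun a b x y (d : Fin n → Fin 2) w =>
          (PProjN d w * (Matrix.of (fun i t => L l (i, t)) * σ a b x y *
            (Matrix.of fun i t => L l (i, t))ᴴ)ᵀ).trace := by
      funext a b x y d w
      simp only [Finset.sum_apply]
      rw [trace_conjTranspose_mul_self_mul_kronecker]
      refine Finset.sum_congr rfl fun l _ => ?_
      rw [← Matrix.trace_transpose, Matrix.transpose_mul, Matrix.transpose_transpose,
        Matrix.trace_mul_comm]
    rw [this, ← LinearMap.toAddMonoidHom_coe, map_sum, Complex.re_sum]
    exact Finset.sum_nonneg fun l _ => hcone _ (hτ.conj _).transpose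
  have htransposed : ∀ K : Matrix ((Fin n → Fin 2) × (Fin n → Fin 2)) _ ℂ, K.PosSemidef →
      0 ≤ (bellFunctional f fun a b x y d w =>
        (K * ((PProjN d w)ᵀ ⊗ₖ σ a b x y)).trace).re := by
    intro K hK
    obtain ⟨L, rfl⟩ := hK.exists_eq_conjTranspose_mul_self
    have : (fun a b x y (d : Fin n → Fin 2) w =>
          ((Lᴴ * L) * ((PProjN d w)ᵀ ⊗ₖ σ a b x y)).trace) =
        ∑ l, fun a b x y (d : Fin n → Fin 2) w =>
          (PProjN d w * (Matrix.of (fun i t => L l (i, t)) * σ a b x y *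
            (Matrix.of fun i t => L l (i, t))ᴴ)).trace := by
      funext a b x y d w
      simp only [Finset.sum_apply]
      rw [trace_conjTranspose_mul_self_mul_kronecker, Matrix.transpose_transpose]
    rw [this, ← LinearMap.toAddMonoidHom_coe, map_sum, Complex.re_sum]
    exact Finset.sum_nonneg fun l _ => hcone _ (hτ.conj _)
  have hsplit : (fun a b x y (d : Fin n → Fin 2) w =>
        (M₀ * (sigmaRN r d w ⊗ₖ σ a b x y)).trace) =
      (r : ℂ) • (fun a b x y (d : Fin n → Fin 2) w =>
        (M₀.submatrix (fun p : (Fin n → Fin 2) × (Fin n → Fin 2) => ((p.1, 0), p.2))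
            (fun p : (Fin n → Fin 2) × (Fin n → Fin 2) => ((p.1, 0), p.2)) *
          (PProjN d w ⊗ₖ σ a b x y)).trace) +
      ((1 - r : ℝ) : ℂ) • (fun a b x y (d : Fin n → Fin 2) w =>
        (M₀.submatrix (fun p : (Fin n → Fin 2) × (Fin n → Fin 2) => ((p.1, 1), p.2))
            (fun p : (Fin n → Fin 2) × (Fin n → Fin 2) => ((p.1, 1), p.2)) *
          ((PProjN d w)ᵀ ⊗ₖ σ a b x y)).trace) := by
    funext a b x y d w
    simp only [sigmaRN, Pi.add_apply, Pi.smul_apply, Matrix.add_kronecker,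
      Matrix.smul_kronecker, Matrix.mul_add, Matrix.mul_smul, Matrix.trace_add,
      Matrix.trace_smul, (trace_mul_kronecker_kronecker _ _ _).1,
      (trace_mul_kronecker_kronecker _ _ _).2]
  change 0 ≤ (bellFunctional f fun a b x y d w =>
    (M₀ * (sigmaRN r d w ⊗ₖ σ a b x y)).trace).re
  rw [hsplit, map_add, map_smul, map_smul, smul_eq_mul, smul_eq_mul, Complex.add_re,
    Complex.re_ofReal_mul, Complex.re_ofReal_mul]
  exact add_nonneg (mul_nonneg hr0 (hdirect _ (hM₀.submatrix _)))
    (mul_nonneg (sub_nonneg.mpr hr1) (htransposed _ (hM₀.submatrix _)))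
end
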